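/- For ν > 1, a ∈ F_{2^{m_1}}^* and b ∈ F_4^*, the Walsh transform of f_{a,b} at 0 satisfies 3·(W_{f_{a,b}}(0) − 1) = −(2^{m_1} − 1)·(1 − K_{m_1}(a)). -/

import Mathlib

open Finset

attribute [local instance] Classical.propDecidable

noncomputable section

/-- The absolute trace `Tr^k` of `GF(2^k)`, as a function on an ambient field of
characteristic two containing `GF(2^k)`. -/
def absTr {F : Type*} [Field F] (k : ℕ) (x : F) : F :=
  ∑ i ∈ Finset.range k, x ^ 2 ^ i

/-- The relative field trace `Tr^k_j` from `GF(2^k)` to `GF(2^j)`. -/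
def relTr {F : Type*} [Field F] (k j : ℕ) (x : F) : F :=
  ∑ i ∈ Finset.range (k / j), x ^ 2 ^ (j * i)

/-- `(-1)^b` for `b ∈ F_2`, viewed inside an ambient field of characteristic two. -/
def sgn {F : Type*} [Field F] (b : F) : ℤ := if b = 0 then 1 else -1

/-- The subfield `GF(2^k)` of the ambient field, as a finset. -/
def gf (F : Type*) [Field F] [Fintype F] (k : ℕ) : Finset F :=
  Finset.univ.filter fun x => x ^ 2 ^ k = x

/-- The trace of `F_4` down to `F_2`, `tr_2(y) = y + y²`. -/
def tr2 {F : Type*} [Field F] (y : F) : F := y + y ^ 2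

/-- The cubic multiplicative character `χ_k(x) = x^((2^k-1)/3)` of `GF(2^k)`. -/
def chi {F : Type*} [Field F] (k : ℕ) (x : F) : F := x ^ ((2 ^ k - 1) / 3)

/-- The Walsh transform at `ω` of a Boolean function on `GF(2^n)`
(with values in `F_2` inside the ambient field). -/
def walsh {F : Type*} [Field F] [Fintype F] (n : ℕ) (f : F → F) (ω : F) : ℤ :=
  ∑ x : F, sgn (f x + absTr n (ω * x))

/-- The binary Kloosterman sum `K_k(a)` (with the convention `0⁻¹ = 0`). -/
def kloo {F : Type*} [Field F] [Fintype F] (k : ℕ) (a : F) : ℤ :=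
  ∑ x ∈ gf F k, sgn (absTr k (a * x + x⁻¹))

/-- The binary cubic sum `C_k(a,b)`. -/
def cub {F : Type*} [Field F] [Fintype F] (k : ℕ) (a b : F) : ℤ :=
  ∑ x ∈ gf F k, sgn (absTr k (a * x ^ 3 + b * x))

/-- `f_a(x) = Tr^n(a · x^(2^{m₁}-1))`. -/
def fA {F : Type*} [Field F] (n m1 : ℕ) (a x : F) : F :=
  absTr n (a * x ^ (2 ^ m1 - 1))

/-- `g_b(x) = tr_2(b · χ_n(x))`. -/
def gB {F : Type*} [Field F] (n : ℕ) (b x : F) : F := tr2 (b * chi n x)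

/-- The binomial Boolean function `f_{a,b} = f_a + g_b`. -/
def fAB {F : Type*} [Field F] (n m1 : ℕ) (a b x : F) : F :=
  fA n m1 a x + gB n b x

/-- `U`, the image of `U_1 × ⋯ × U_ν` in `GF(2^n)^*` under multiplication, where
`U_i` is the subgroup of `(2^{m_i}+1)`-th roots of unity and `m_i = 2^{ν-i}·m`. -/
def bigU (F : Type*) [Field F] [Fintype F] (ν m : ℕ) : Finset F :=
  Finset.univ.filter fun u => ∃ c : Fin ν → F,
    (∀ i : Fin ν, c i ^ (2 ^ (2 ^ (ν - 1 - (i : ℕ)) * m) + 1) = 1) ∧ u = ∏ i, c i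

section AbsoluteTrace

variable {F : Type*} [Field F]

theorem absTr_add_exponent (k l : ℕ) (x : F) :
    absTr (k + l) x = absTr k x + absTr l (x ^ 2 ^ k) := by
  simp only [absTr, sum_range_add, ← pow_mul, ← pow_add]

theorem card_absTr_eq_zero_le [Fintype F] (k : ℕ) :
    #{x : F | absTr (k + 1) x = 0} ≤ 2 ^ k := by
  let P : Polynomial F := ∑ i ∈ range (k + 1), Polynomial.X ^ 2 ^ i
  have hcoeff : P.coeff 1 = 1 := by
    have h (i : ℕ) : (1 = 2 ^ i) ↔ i = 0 := by
      rw [eq_comm, Nat.pow_eq_one]; simp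
    simp [P, Polynomial.coeff_X_pow, h]
  have hP : P ≠ 0 := fun h => by simp [h] at hcoeff
  have hdeg : P.natDegree ≤ 2 ^ k := by
    refine Polynomial.natDegree_sum_le_of_forall_le _ _ fun i hi => ?_
    rw [Polynomial.natDegree_X_pow]
    exact Nat.pow_le_pow_right two_pos (Nat.lt_succ_iff.mp (mem_range.mp hi))
  refine le_trans (Polynomial.card_le_degree_of_subset_roots fun x hx => ?_) hdeg
  rw [Polynomial.mem_roots hP, Polynomial.IsRoot.def, Polynomial.eval_finsetSum]
  simpa [absTr] using (mem_filter.mp hx).2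

variable [CharP F 2]

theorem sgn_add {x y : F} (hx : x ^ 2 = x) (hy : y ^ 2 = y) : sgn (x + y) = sgn x * sgn y := by
  rcases eq_zero_or_one_of_sq_eq_self hx with rfl | rfl <;>
    rcases eq_zero_or_one_of_sq_eq_self hy with rfl | rfl <;>
    simp [sgn, CharTwo.add_self_eq_zero]

theorem absTr_add (k : ℕ) (x y : F) : absTr k (x + y) = absTr k x + absTr k y := by
  simp only [absTr, add_pow_char_pow, sum_add_distrib]

theorem absTr_sq (k : ℕ) (x : F) : absTr k (x ^ 2) = absTr k x ^ 2 := by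
  simp only [absTr, CharTwo.sum_sq, ← pow_mul, mul_comm]

theorem absTr_sq_add_self (k : ℕ) (x : F) : absTr k (x ^ 2 + x) = x ^ 2 ^ k + x := by
  induction k with
  | zero => simp [absTr, CharTwo.add_self_eq_zero]
  | succ k ih =>
    have h : absTr (k + 1) (x ^ 2 + x) = absTr k (x ^ 2 + x) + (x ^ 2 + x) ^ 2 ^ k := by
      simp only [absTr, sum_range_succ]
    rw [h, ih, add_pow_char_pow, ← pow_mul, pow_succ' 2 k]
    linear_combination CharTwo.add_self_eq_zero (x ^ 2 ^ k)

theorem absTr_sq_eq_self {k : ℕ} {x : F} (hx : x ^ 2 ^ k = x) : absTr k x ^ 2 = absTr k x := by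
  have h := absTr_sq_add_self k x
  rwa [hx, CharTwo.add_self_eq_zero, absTr_add, absTr_sq, CharTwo.add_eq_zero] at h

theorem absTr_eq_zero_or_one {k : ℕ} {x : F} (hx : x ^ 2 ^ k = x) :
    absTr k x = 0 ∨ absTr k x = 1 :=
  eq_zero_or_one_of_sq_eq_self (absTr_sq_eq_self hx)

theorem eq_or_eq_add_one_of_sq_add_self_eq {y z : F} (h : y ^ 2 + y = z ^ 2 + z) :
    y = z ∨ y = z + 1 := by
  have hmul : (y - z) * (y - (z + 1)) = 0 := by
    linear_combination h - (y - z) * CharTwo.two_eq_zero (R := F) * (z + 1)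
  exact (mul_eq_zero.mp hmul).imp sub_eq_zero.mp sub_eq_zero.mp

/-- The values of `tr2` on the cube roots of unity. -/
theorem sum_sgn_tr2 {ζ t : F} (hζ : ζ ^ 3 = 1) (hζ1 : ζ ≠ 1) (ht : t ^ 3 = 1) :
    sgn (tr2 t) + sgn (tr2 (ζ * t)) + sgn (tr2 (ζ ^ 2 * t)) = -1 := by
  have htwo := CharTwo.two_eq_zero (R := F)
  have hquad : ζ ^ 2 + ζ + 1 = 0 :=
    (mul_eq_zero.mp (show (ζ - 1) * (ζ ^ 2 + ζ + 1) = 0 by linear_combination hζ)).resolve_left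
      (sub_ne_zero.mpr hζ1)
  have h1 : tr2 (1 : F) = 0 := by simp [tr2, CharTwo.add_self_eq_zero]
  have hz : tr2 ζ = 1 := by unfold tr2; linear_combination hquad - htwo
  have hz2 : tr2 (ζ ^ 2) = 1 := by unfold tr2; linear_combination hquad + ζ * hζ - htwo
  have hfac : (t - 1) * ((t - ζ) * (t - ζ ^ 2)) = 0 := by
    linear_combination ht + (-t ^ 2 + t) * hquad + (1 - t) * (-hζ)
  rcases mul_eq_zero.mp hfac with h | h
  · rw [sub_eq_zero.mp h, mul_one, mul_one, h1, hz, hz2]; simp [sgn]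
  rcases mul_eq_zero.mp h with h | h
  · rw [sub_eq_zero.mp h, ← sq, ← pow_succ, hζ, h1, hz, hz2]; simp [sgn]
  · have h4 : ζ ^ 2 * ζ ^ 2 = ζ := by linear_combination ζ * hζ
    rw [sub_eq_zero.mp h, ← pow_succ', hζ, h4, h1, hz, hz2]; simp [sgn]

end AbsoluteTrace

section QuadraticExtension

variable {F : Type*} [Field F] [Fintype F]

theorem mem_gf {k : ℕ} {x : F} : x ∈ gf F k ↔ x ^ 2 ^ k = x := by simp [gf]

theorem pow_pow_of_card {k : ℕ} (hF : Fintype.card F = 2 ^ (k + k)) (x : F) :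
    (x ^ 2 ^ k) ^ 2 ^ k = x := by
  rw [← pow_mul, ← pow_add, ← hF, FiniteField.pow_card]

/-- Inversion permutes a subfield. -/
theorem sum_gf_inv {k : ℕ} (G : F → ℤ) : ∑ x ∈ gf F k, G x⁻¹ = ∑ x ∈ gf F k, G x := by
  have h : ∀ x ∈ gf F k, x⁻¹ ∈ gf F k := fun x hx => by
    rw [mem_gf] at hx ⊢; rw [inv_pow, hx]
  exact sum_nbij' (·⁻¹) (·⁻¹) h h (fun x _ => inv_inv x) (fun x _ => inv_inv x) fun _ _ => rfl

variable [CharP F 2]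

/-- Additive form of Hilbert's Theorem 90 for the extension of the prime field. -/
theorem exists_sq_add_self_eq {n : ℕ} (hn : n ≠ 0) (hF : Fintype.card F = 2 ^ n) {w : F}
    (hw : absTr n w = 0) : ∃ z : F, z ^ 2 + z = w := by
  obtain ⟨l, rfl⟩ := Nat.exists_eq_succ_of_ne_zero hn
  have hcard : #(univ : Finset F) ≤ 2 * #(univ.image fun z : F => z ^ 2 + z) := by
    refine card_le_mul_card_image _ _ fun w hw => ?_
    obtain ⟨z, -, rfl⟩ := mem_image.mp hw
    refine le_trans (card_le_card (t := {z, z + 1}) fun y hy => ?_) card_le_two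
    have hy' : y ^ 2 + y = z ^ 2 + z := by simpa using hy
    simpa using eq_or_eq_add_one_of_sq_add_self_eq hy'
  have hsub : (univ.image fun z : F => z ^ 2 + z) ⊆ ({x : F | absTr (l + 1) x = 0} : Finset F) := by
    intro w hw
    obtain ⟨z, -, rfl⟩ := mem_image.mp hw
    rw [mem_filter, absTr_sq_add_self, ← hF, FiniteField.pow_card]
    exact ⟨mem_univ _, CharTwo.add_self_eq_zero z⟩
  have heq := eq_of_subset_of_card_le hsub (by
    have h1 := card_absTr_eq_zero_le (F := F) l
    rw [card_univ, hF, pow_succ] at hcard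
    lia)
  have hmem : w ∈ ({x : F | absTr (l + 1) x = 0} : Finset F) := by simpa using hw
  rw [← heq] at hmem
  simpa using hmem

theorem exists_absTr_eq_one {k : ℕ} (hk : k ≠ 0) (hF : Fintype.card F = 2 ^ (k + k)) :
    ∃ t ∈ gf F k, absTr k t = 1 := by
  obtain ⟨x, hx⟩ : ∃ x : F, absTr (k + k) x ≠ 0 := by
    by_contra! h
    obtain ⟨l, hl⟩ := Nat.exists_eq_succ_of_ne_zero (show k + k ≠ 0 by lia)
    have h1 := card_absTr_eq_zero_le (F := F) l
    rw [← Nat.succ_eq_add_one, ← hl, filter_true_of_mem fun x _ => h x, card_univ, hF, hl,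
      Nat.pow_succ] at h1
    have := Nat.two_pow_pos l
    lia
  have ht : (x + x ^ 2 ^ k) ^ 2 ^ k = x + x ^ 2 ^ k := by
    rw [add_pow_char_pow, pow_pow_of_card hF, add_comm]
  refine ⟨_, mem_gf.mpr ht, (absTr_eq_zero_or_one ht).resolve_left ?_⟩
  rwa [absTr_add, ← absTr_add_exponent]

theorem sum_sgn_absTr {k : ℕ} (hk : k ≠ 0) (hF : Fintype.card F = 2 ^ (k + k)) {a : F}
    (ha : a ^ 2 ^ k = a) (ha0 : a ≠ 0) : ∑ x ∈ gf F k, sgn (absTr k (a * x)) = 0 := by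
  obtain ⟨t, ht, ht1⟩ := exists_absTr_eq_one hk hF
  rw [mem_gf] at ht
  have hshift : ∀ x ∈ gf F k, x + a⁻¹ * t ∈ gf F k := fun x hx => by
    rw [mem_gf] at hx ⊢
    rw [add_pow_char_pow, mul_pow, inv_pow, hx, ha, ht]
  have hinv (x : F) : x + a⁻¹ * t + a⁻¹ * t = x := CharTwo.add_cancel_right _ _
  have h : ∑ x ∈ gf F k, sgn (absTr k (a * x)) = ∑ x ∈ gf F k, -sgn (absTr k (a * x)) := by
    refine sum_nbij' (· + a⁻¹ * t) (· + a⁻¹ * t) hshift hshift (fun x _ => hinv x)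
      (fun x _ => hinv x) fun x hx => ?_
    rw [mem_gf] at hx
    rw [mul_add, mul_inv_cancel_left₀ ha0, absTr_add, ht1,
      sgn_add (absTr_sq_eq_self (by rw [mul_pow, ha, hx])) (one_pow 2)]
    simp [sgn]
  rw [sum_neg_distrib] at h
  lia

/-- The map `z ↦ z² + z` is two-to-one from the elements with `z^(2^k) = z + 1` onto the
elements of trace one in the subfield. -/
theorem sum_sq_add_self {k : ℕ} (hk : k ≠ 0) (hF : Fintype.card F = 2 ^ (k + k)) (G : F → ℤ) :
    ∑ z : F with z ^ 2 ^ k = z + 1, G (z ^ 2 + z)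
      = ∑ w ∈ gf F k, (1 - sgn (absTr k w)) * G w := by
  have hmaps : ∀ z ∈ ({z : F | z ^ 2 ^ k = z + 1} : Finset F), z ^ 2 + z ∈ gf F k := by
    intro z hz
    rw [mem_filter] at hz
    rw [mem_gf, add_pow_char_pow, pow_right_comm, hz.2, CharTwo.add_sq]
    linear_combination CharTwo.add_self_eq_zero (1 : F)
  rw [← sum_fiberwise_of_maps_to' hmaps]
  refine sum_congr rfl fun w hw => ?_
  rw [mem_gf] at hw
  rw [sum_const, nsmul_eq_mul, filter_filter]
  congr 1
  have htr {z : F} (hz : z ^ 2 + z = w) : absTr k w = z ^ 2 ^ k + z := by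
    rw [← hz, absTr_sq_add_self]
  rcases absTr_eq_zero_or_one hw with h0 | h1
  · have : ({z : F | z ^ 2 ^ k = z + 1 ∧ z ^ 2 + z = w} : Finset F) = ∅ := by
      refine filter_eq_empty_iff.mpr fun z _ ⟨hz, hzw⟩ => ?_
      have := htr hzw
      rw [h0, hz] at this
      exact one_ne_zero (α := F) (by linear_combination -this - CharTwo.add_self_eq_zero z)
    simp [this, h0, sgn]
  · obtain ⟨z, hz⟩ := exists_sq_add_self_eq (show k + k ≠ 0 by lia) hF (w := w) (by
      rw [absTr_add_exponent, hw, CharTwo.add_self_eq_zero])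
    have : ({z : F | z ^ 2 ^ k = z + 1 ∧ z ^ 2 + z = w} : Finset F) = {z, z + 1} := by
      ext y
      simp only [mem_filter, mem_univ, true_and, mem_insert, mem_singleton]
      constructor
      · rintro ⟨-, hy⟩
        exact eq_or_eq_add_one_of_sq_add_self_eq (hy.trans hz.symm)
      · intro hy
        have hyw : y ^ 2 + y = w := by
          rcases hy with rfl | rfl
          · exact hz
          · linear_combination hz + (z + 1) * CharTwo.two_eq_zero (R := F)
        refine ⟨?_, hyw⟩
        have := htr hyw
        rw [h1] at this
        linear_combination -this - CharTwo.add_self_eq_zero y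
    rw [this, card_pair (by simp)]
    simp [h1, sgn]

/-- The exponential sum over the `(2^k+1)`-th roots of unity as a Kloosterman sum. -/
theorem sum_roots_of_unity_eq_one_sub_kloo {k : ℕ} (hk : k ≠ 0)
    (hF : Fintype.card F = 2 ^ (k + k)) {a : F} (ha : a ^ 2 ^ k = a) (ha0 : a ≠ 0) :
    ∑ u : F with u ^ (2 ^ k + 1) = 1, sgn (absTr (k + k) (a * u)) = 1 - kloo k a := by
  have hone : (1 : F) ∈ ({u : F | u ^ (2 ^ k + 1) = 1} : Finset F) := by simp
  have hfrob {u : F} (hu : u ^ (2 ^ k + 1) = 1) : u ^ 2 ^ k = u⁻¹ :=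
    eq_inv_of_mul_eq_one_left (by rw [← pow_succ, hu])
  have htwo := CharTwo.two_eq_zero (R := F)
  have hbij : ∑ u ∈ ({u : F | u ^ (2 ^ k + 1) = 1} : Finset F).erase 1,
        sgn (absTr (k + k) (a * u))
      = ∑ z : F with z ^ 2 ^ k = z + 1, sgn (absTr k (a * (z ^ 2 + z)⁻¹)) := by
    refine sum_nbij' (fun u => (u + 1)⁻¹) (fun z => (z + 1) * z⁻¹) ?_ ?_ ?_ ?_ ?_
    · intro u hu
      simp only [mem_erase, mem_filter, mem_univ, true_and] at hu ⊢
      have hu0 : u ≠ 0 := by rintro rfl; simp at hu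
      have hu1 : u + 1 ≠ 0 := fun h => hu.1 (CharTwo.add_eq_zero.mp h)
      have hu2 : u⁻¹ + 1 = (u + 1) * u⁻¹ := by field_simp; ring
      rw [inv_pow, add_pow_char_pow, hfrob hu.2, one_pow, hu2]
      field_simp
      linear_combination -htwo
    · intro z hz
      simp only [mem_erase, mem_filter, mem_univ, true_and] at hz ⊢
      have hz0 : z ≠ 0 := by
        rintro rfl
        simp at hz
      have hz1 : z + 1 ≠ 0 := by rw [← hz]; exact pow_ne_zero _ hz0
      constructor
      · intro h
        field_simp at h
        simp at h
      · have : (z + 1) ^ 2 ^ k = z := by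
          rw [← hz, pow_pow_of_card hF]
        rw [pow_succ, mul_pow, this, inv_pow, hz]
        field_simp
    · intro u hu
      simp only [mem_erase, mem_filter, mem_univ, true_and] at hu
      have hu1 : u + 1 ≠ 0 := fun h => hu.1 (CharTwo.add_eq_zero.mp h)
      field_simp
      linear_combination htwo
    · intro z hz
      simp only [mem_filter, mem_univ, true_and] at hz
      have hz0 : z ≠ 0 := by
        rintro rfl
        simp at hz
      have : (z + 1) * z⁻¹ + 1 = z⁻¹ := by
        field_simp
        linear_combination z * htwo
      simp only [this, inv_inv]
    · intro u hu
      simp only [mem_erase, mem_filter, mem_univ, true_and] at hu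
      have hu0 : u ≠ 0 := by rintro rfl; simp at hu
      have hu1 : u + 1 ≠ 0 := fun h => hu.1 (CharTwo.add_eq_zero.mp h)
      have hsum : ((u + 1)⁻¹ ^ 2 + (u + 1)⁻¹)⁻¹ = u + u⁻¹ := by
        have h : (u + 1)⁻¹ ^ 2 + (u + 1)⁻¹ = u * ((u + 1) ^ 2)⁻¹ := by
          field_simp
          linear_combination htwo
        rw [h, mul_inv, inv_inv]
        field_simp
        linear_combination u * htwo
      rw [absTr_add_exponent, mul_pow, ha, hfrob hu.2, ← absTr_add, ← mul_add, hsum]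
  have hterm (w : F) (hw : w ∈ gf F k) : (1 - sgn (absTr k w)) * sgn (absTr k (a * w⁻¹))
      = sgn (absTr k (a * w⁻¹)) - sgn (absTr k (a * w⁻¹ + w⁻¹⁻¹)) := by
    rw [mem_gf] at hw
    rw [inv_inv, absTr_add, sgn_add (absTr_sq_eq_self (by rw [mul_pow, inv_pow, ha, hw]))
      (absTr_sq_eq_self hw)]
    ring
  rw [← add_sum_erase _ _ hone, hbij,
    sum_sq_add_self hk hF fun w => sgn (absTr k (a * w⁻¹)), sum_congr rfl hterm,
    sum_sub_distrib, sum_gf_inv fun x => sgn (absTr k (a * x)), sum_sgn_absTr hk hF ha ha0,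
    sum_gf_inv fun x => sgn (absTr k (a * x + x⁻¹)), mul_one, absTr_add_exponent, ha,
    CharTwo.add_self_eq_zero]
  simp [kloo, sgn]
  ring

end QuadraticExtension

section Units

variable {F : Type*} [Field F]

theorem units_val_pow_eq_one {x : Fˣ} {n : ℕ} : (x : F) ^ n = 1 ↔ x ^ n = 1 := by
  rw [← Units.val_pow_eq_pow_val, Units.val_eq_one]

variable [Fintype F]

theorem sum_eq_add_sum_units (G : F → ℤ) : ∑ x, G x = G 0 + ∑ x : Fˣ, G x := by
  rw [Fintype.sum_eq_add_sum_subtype_ne G 0]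
  congr 1
  exact (Fintype.sum_equiv unitsEquivNeZero _ _ fun _ => rfl).symm

/-- Raising to the power `q - 1` maps the units of a field of order `q²` onto the `(q+1)`-th
roots of unity, with all fibres of size `q - 1`. -/
theorem sum_units_pow_sub_one {q : ℕ} (hq : 1 < q) (hF : Fintype.card F = q * q) (φ : F → ℤ) :
    ∑ x : Fˣ, φ ((x : F) ^ (q - 1))
      = (q - 1) * ∑ u : F with u ^ (q + 1) = 1, φ u := by
  obtain ⟨r, rfl⟩ := Nat.exists_eq_add_of_lt hq
  have hcard : Nat.card Fˣ = (1 + r + 1 + 1) * (r + 1) := by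
    rw [Nat.card_units, Nat.card_eq_fintype_card, hF]
    exact Nat.sub_eq_of_eq_add (by ring)
  have hr : 1 + r + 1 - 1 = r + 1 := by lia
  rw [hr]
  have hmaps : ∀ x ∈ (univ : Finset Fˣ),
      (x : F) ^ (r + 1) ∈ ({u : F | u ^ (1 + r + 1 + 1) = 1} : Finset F) := fun x _ => by
    rw [mem_filter, ← pow_mul, mul_comm, ← hcard]
    exact ⟨mem_univ _, units_val_pow_eq_one.mpr pow_card_eq_one'⟩
  rw [← sum_fiberwise_of_maps_to' hmaps, mul_sum]
  refine sum_congr rfl fun u hu => ?_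
  rw [sum_const, nsmul_eq_mul]
  congr 1
  have hu1 : u ^ (1 + r + 1 + 1) = 1 := by simpa using hu
  obtain ⟨v, rfl⟩ : ∃ v : Fˣ, (v : F) = u :=
    IsUnit.of_pow_eq_one hu1 (by lia)
  obtain ⟨g, hg⟩ := IsCyclic.exists_generator (α := Fˣ)
  obtain ⟨y, rfl⟩ : ∃ y : Fˣ, y ^ (r + 1) = v := by
    obtain ⟨j, rfl⟩ := (Submonoid.mem_powers_iff _ _).mp (mem_powers_iff_mem_zpowers.mpr (hg v))
    have hdvd : Nat.card Fˣ ∣ (1 + r + 1 + 1) * j := by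
      rw [← orderOf_eq_card_of_forall_mem_zpowers hg]
      refine orderOf_dvd_of_pow_eq_one ?_
      rw [mul_comm, pow_mul]
      exact units_val_pow_eq_one.mp hu1
    rw [hcard] at hdvd
    obtain ⟨l, rfl⟩ := Nat.dvd_of_mul_dvd_mul_left (by lia) hdvd
    exact ⟨g ^ l, by rw [← pow_mul, mul_comm]⟩
  have hker := IsCyclic.card_powMonoidHom_ker (G := Fˣ) (r + 1)
  rw [hcard, Nat.gcd_mul_left_left, Nat.card_eq_fintype_card] at hker
  have hfib : #{x : Fˣ | (x : F) ^ (r + 1) = ((y ^ (r + 1) : Fˣ) : F)} = r + 1 := by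
    refine Eq.trans ?_ ((Fintype.card_subtype _).symm.trans hker)
    refine card_nbij' (y⁻¹ * ·) (y * ·) ?_ ?_ ?_ ?_
    · intro x hx
      have hx' : x ^ (r + 1) = y ^ (r + 1) := by
        simp only [coe_filter, mem_univ, true_and, Set.mem_ofPred_eq] at hx
        exact Units.ext (by rwa [Units.val_pow_eq_pow_val])
      simp [MonoidHom.mem_ker, mul_pow, hx']
    · intro x hx
      have hx' : x ^ (r + 1) = 1 := by simpa [MonoidHom.mem_ker] using hx
      have hx'' : (x : F) ^ (r + 1) = 1 := units_val_pow_eq_one.mpr hx'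
      simp [mul_pow, hx'']
    · intro x _; simp
    · intro x _; simp
  rw [hfib]
  push_cast
  ring

/-- A unit whose `(q-1)`-th power is trivial and whose cubic character is not. -/
theorem exists_unit_cubic_nonresidue {d : ℕ}
    (hF : Fintype.card F = (3 * d + 1) * (3 * d + 1)) (hd : d ≠ 0) :
    ∃ c : Fˣ, c ^ (3 * d) = 1 ∧ c ^ (d * (3 * d + 2)) ≠ 1 := by
  have hcard : Nat.card Fˣ = (3 * d + 2) * (3 * d) := by
    rw [Nat.card_units, Nat.card_eq_fintype_card, hF]
    exact Nat.sub_eq_of_eq_add (by ring)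
  obtain ⟨g, hg⟩ := IsCyclic.exists_generator (α := Fˣ)
  refine ⟨g ^ (3 * d + 2), ?_, fun h => ?_⟩
  · rw [← pow_mul, ← hcard]
    exact pow_card_eq_one'
  · rw [← pow_mul] at h
    have hdvd := orderOf_dvd_of_pow_eq_one h
    rw [orderOf_eq_card_of_forall_mem_zpowers hg, hcard] at hdvd
    have h2 := Nat.dvd_of_mul_dvd_mul_left (by lia) hdvd
    rw [mul_comm 3 d] at h2
    have h3 := Nat.dvd_of_mul_dvd_mul_left (by lia) h2
    lia

/-- Averaging over the cubic character. -/
theorem three_mul_sum_units [CharP F 2] {d : ℕ}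
    (hF : Fintype.card F = (3 * d + 1) * (3 * d + 1)) (hd : d ≠ 0) {b : F} (hb : b ^ 3 = 1)
    (φ : F → ℤ) :
    3 * ∑ x : Fˣ, φ ((x : F) ^ (3 * d)) * sgn (tr2 (b * (x : F) ^ (d * (3 * d + 2))))
      = -∑ x : Fˣ, φ ((x : F) ^ (3 * d)) := by
  obtain ⟨c, hc, hc1⟩ := exists_unit_cubic_nonresidue hF hd
  have hcF : (c : F) ^ (3 * d) = 1 := units_val_pow_eq_one.mpr hc
  let H : Fˣ → ℤ := fun x => φ ((x : F) ^ (3 * d)) * sgn (tr2 (b * (x : F) ^ (d * (3 * d + 2))))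
  have hshift (e : Fˣ) : ∑ x, H (e * x) = ∑ x, H x :=
    Fintype.sum_equiv (Equiv.mulLeft e) _ _ fun _ => rfl
  have hpt (x : Fˣ) : H x + H (c * x) + H (c ^ 2 * x) = -φ ((x : F) ^ (3 * d)) := by
    have hx : ((x : F) ^ (d * (3 * d + 2))) ^ 3 = 1 := by
      have h := FiniteField.pow_card_sub_one_eq_one (x : F) x.ne_zero
      rw [hF, Nat.sub_eq_of_eq_add (show (3 * d + 1) * (3 * d + 1)
        = d * (3 * d + 2) * 3 + 1 by ring)] at h
      rw [← pow_mul, h]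
    have hζ : ((c : F) ^ (d * (3 * d + 2))) ^ 3 = 1 := by
      rw [← pow_mul, show d * (3 * d + 2) * 3 = 3 * d * (3 * d + 2) by ring, pow_mul, hcF, one_pow]
    have hζ1 : (c : F) ^ (d * (3 * d + 2)) ≠ 1 := mt units_val_pow_eq_one.mp hc1
    have hsum := sum_sgn_tr2 hζ hζ1 (t := b * (x : F) ^ (d * (3 * d + 2)))
      (by rw [mul_pow, hb, hx, one_mul])
    have hφ2 : ((c : F) ^ 2) ^ (3 * d) = 1 := by rw [pow_right_comm, hcF, one_pow]
    simp only [H, Units.val_mul, Units.val_pow_eq_pow_val, mul_pow _ (x : F), hcF, hφ2, one_mul,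
      mul_left_comm b, pow_right_comm (c : F) 2 (d * (3 * d + 2))]
    linear_combination φ ((x : F) ^ (3 * d)) * hsum
  calc 3 * ∑ x, H x = ∑ x, H x + ∑ x, H (c * x) + ∑ x, H (c ^ 2 * x) := by
        rw [hshift, hshift]; ring
    _ = _ := by
        rw [← sum_add_distrib, ← sum_add_distrib, ← sum_neg_distrib]
        exact sum_congr rfl fun x _ => hpt x

end Units

/-- For `ν > 1`, `a ∈ F_{2^{m₁}}^*` and `b ∈ F_4^*`:
`3·(W_{f_{a,b}}(0) − 1) = −(2^{m₁} − 1)·(1 − K_{m₁}(a))`. -/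
theorem walsh_at_zero_even_case
    {F : Type*} [Field F] [Fintype F]
    (n ν m : ℕ) (hν : 1 < ν) (hm : Odd m) (hn : n = 2 ^ ν * m)
    (hF : Fintype.card F = 2 ^ n)
    (a b : F) (ha : a ^ 2 ^ (2 ^ (ν - 1) * m) = a) (ha0 : a ≠ 0)
    (hb : b ^ 3 = 1) (hb0 : b ≠ 0) :
    3 * (walsh n (fAB n (2 ^ (ν - 1) * m) a b) 0 - 1)
      = -((2 ^ (2 ^ (ν - 1) * m) - 1) * (1 - kloo (2 ^ (ν - 1) * m) a)) := by
  obtain ⟨j, hj⟩ : ∃ j, 2 ^ (ν - 1) * m = 2 * j := by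
    obtain ⟨i, rfl⟩ := Nat.exists_eq_add_of_lt hν
    exact ⟨2 ^ i * m, by rw [show 1 + i + 1 - 1 = i + 1 by lia]; ring⟩
  have hnk : n = 2 ^ (ν - 1) * m + 2 ^ (ν - 1) * m := by
    obtain ⟨i, rfl⟩ := Nat.exists_eq_add_of_lt hν
    rw [hn, show 1 + i + 1 - 1 = i + 1 by lia]
    ring
  have hk : 2 ^ (ν - 1) * m ≠ 0 := mul_ne_zero (by positivity) hm.pos.ne'
  generalize 2 ^ (ν - 1) * m = k at *
  subst hnk
  obtain ⟨d, hd⟩ : ∃ d, 2 ^ k = 3 * d + 1 := by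
    have h : 2 ^ k % 3 = 1 := by rw [hj, pow_mul, Nat.pow_mod]; simp
    exact ⟨2 ^ k / 3, by lia⟩
  have hd0 : d ≠ 0 := by
    rintro rfl
    simp [hk] at hd
  have : CharP F 2 := charP_of_card_eq_prime_pow hF
  have hFq : Fintype.card F = (3 * d + 1) * (3 * d + 1) := by rw [hF, pow_add, hd]
  have hexp : (2 ^ (k + k) - 1) / 3 = d * (3 * d + 2) := by
    rw [pow_add, hd, Nat.sub_eq_of_eq_add (show (3 * d + 1) * (3 * d + 1)
      = d * (3 * d + 2) * 3 + 1 by ring), Nat.mul_div_cancel _ three_pos]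
  have habs0 : absTr (k + k) (0 : F) = 0 := by simp [absTr]
  have hfix (x : F) : x ^ 2 ^ (k + k) = x := by rw [← hF, FiniteField.pow_card]
  have hgB (x : Fˣ) : gB (k + k) b (x : F) ^ 2 = gB (k + k) b (x : F) := by
    have h := FiniteField.pow_card_sub_one_eq_one (x : F) x.ne_zero
    rw [hFq, Nat.sub_eq_of_eq_add (show (3 * d + 1) * (3 * d + 1)
      = d * (3 * d + 2) * 3 + 1 by ring), pow_mul] at h
    have ht : (b * chi (k + k) (x : F)) ^ 3 = 1 := by
      rw [mul_pow, hb, chi, hexp, h, one_mul]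
    unfold gB tr2
    rw [CharTwo.add_sq]
    linear_combination (b * chi (k + k) (x : F)) * ht
  have hwalsh : walsh (k + k) (fAB (k + k) k a b) 0 = 1 + ∑ x : Fˣ,
      sgn (absTr (k + k) (a * (x : F) ^ (3 * d)))
        * sgn (tr2 (b * (x : F) ^ (d * (3 * d + 2)))) := by
    rw [walsh, sum_eq_add_sum_units]
    congr 1
    · have h1 : 2 ^ k - 1 ≠ 0 := by lia
      have h2 : (2 ^ (k + k) - 1) / 3 ≠ 0 := by rw [hexp]; positivity
      simp [fAB, fA, gB, chi, tr2, sgn, habs0, h1, h2]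
    · refine sum_congr rfl fun x _ => ?_
      rw [zero_mul, habs0, add_zero, fAB, fA, sgn_add (absTr_sq_eq_self (hfix _)) (hgB x), gB, chi,
        hexp, hd, Nat.add_sub_cancel]
  have hpow := sum_units_pow_sub_one (q := 3 * d + 1) (by lia) hFq
    fun v => sgn (absTr (k + k) (a * v))
  rw [← hd, sum_roots_of_unity_eq_one_sub_kloo hk hF ha ha0, hd, Nat.add_sub_cancel] at hpow
  have hd' : (2 : ℤ) ^ k = ((3 * d + 1 : ℕ) : ℤ) := by exact_mod_cast hd
  rw [hwalsh, add_sub_cancel_left,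
    three_mul_sum_units hFq hd0 hb fun v => sgn (absTr (k + k) (a * v)), hpow, hd']
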